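/- Let N be a finite set with |N| = n, let p ∈ [0,1] with p·n an integer, and let g : 2^N → ℝ be a submodular function (i.e., g(A ∪ {u}) − g(A) ≥ g(B ∪ {u}) − g(B) for all A ⊆ B ⊆ N and u ∈ N \ B). Then the expectation of g(A) when A is chosen by including each element of N independently with probability p is at most the expectation of g(A) when A is chosen uniformly at random among all subsets of N of size exactly p·n. -/

import Mathlib

open Finset

lemma aux_double {α : Type*} [DecidableEq α] (N : Finset α) (k : ℕ) (f : Finset α → ℝ) :
    ∑ A ∈ N.powersetCard k, ∑ u ∈ N \ A, f (insert u A) =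
      ((k : ℝ) + 1) * ∑ B ∈ N.powersetCard (k + 1), f B := by
  have h : ((k : ℝ) + 1) * ∑ B ∈ N.powersetCard (k + 1), f B =
      ∑ B ∈ N.powersetCard (k + 1), ∑ u ∈ B, f B := by
    rw [Finset.mul_sum]
    refine Finset.sum_congr rfl fun B hB => ?_
    rw [Finset.sum_const, (Finset.mem_powersetCard.1 hB).2, nsmul_eq_mul]
    push_cast
    ring
  rw [h, Finset.sum_sigma', Finset.sum_sigma']
  refine Finset.sum_bij' (fun x _ => ⟨insert x.2 x.1, x.2⟩) (fun x _ => ⟨x.1.erase x.2, x.2⟩)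
    ?_ ?_ ?_ ?_ ?_
  · rintro ⟨A, u⟩ hx
    simp only [mem_sigma, mem_powersetCard, mem_sdiff] at hx ⊢
    refine ⟨⟨Finset.insert_subset hx.2.1 hx.1.1, ?_⟩, mem_insert_self _ _⟩
    rw [card_insert_of_notMem hx.2.2, hx.1.2]
  · rintro ⟨A, u⟩ hx
    simp only [mem_sigma, mem_powersetCard, mem_sdiff] at hx ⊢
    refine ⟨⟨(erase_subset _ _).trans hx.1.1, ?_⟩, hx.1.1 hx.2, notMem_erase _ _⟩
    rw [card_erase_of_mem hx.2, hx.1.2]; rfl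
  · rintro ⟨A, u⟩ hx
    simp only [mem_sigma, mem_powersetCard, mem_sdiff] at hx
    simp [erase_insert hx.2.2]
  · rintro ⟨A, u⟩ hx
    simp only [mem_sigma, mem_powersetCard, mem_sdiff] at hx
    simp [insert_erase hx.2]
  · intros; rfl

lemma aux_ineq {α : Type*} [DecidableEq α] (N : Finset α) (k : ℕ) (hk : k + 2 ≤ N.card)
    (g : Finset α → ℝ)
    (hsub : ∀ A B : Finset α, A ⊆ B → B ⊆ N → ∀ u ∈ N, u ∉ B →
      g (B ∪ {u}) - g B ≤ g (A ∪ {u}) - g A) :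
    ((N.card : ℝ) - k) * ((N.card : ℝ) - k - 1) * (∑ A ∈ N.powersetCard k, g A) +
      ((k : ℝ) + 1) * ((k : ℝ) + 2) * (∑ A ∈ N.powersetCard (k + 2), g A) ≤
      2 * (((N.card : ℝ) - k - 1) * ((k : ℝ) + 1) * (∑ A ∈ N.powersetCard (k + 1), g A)) := by
  have h1 : ∑ A ∈ N.powersetCard k, ∑ u ∈ N \ A, ∑ v ∈ N \ (insert u A), g (insert v (insert u A))
      = ((k : ℝ) + 1) * ((k : ℝ) + 2) * (∑ A ∈ N.powersetCard (k + 2), g A) := by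
    rw [aux_double N k (fun B => ∑ v ∈ N \ B, g (insert v B)), aux_double N (k + 1) g]
    push_cast
    ring
  have h2 : ((N.card : ℝ) - k - 1) * ((k : ℝ) + 1) * (∑ A ∈ N.powersetCard (k + 1), g A)
      = ((N.card : ℝ) - k - 1) * ∑ A ∈ N.powersetCard k, ∑ u ∈ N \ A, g (insert u A) := by
    rw [aux_double N k g]; ring
  rw [← h1, h2, ← mul_assoc, mul_sum, mul_sum, ← sum_add_distrib]
  refine sum_le_sum fun A hA => ?_
  obtain ⟨hAN, hAc⟩ := mem_powersetCard.1 hA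
  have hc : ((N \ A).card : ℝ) = (N.card : ℝ) - k := by
    rw [cast_card_sdiff hAN, hAc]
  have e1 : ((N.card : ℝ) - k) * ((N.card : ℝ) - k - 1) * g A =
      ∑ u ∈ N \ A, ((N.card : ℝ) - k - 1) * g A := by
    rw [sum_const, nsmul_eq_mul, hc]; ring
  rw [e1, ← sum_add_distrib]
  have key : ∀ u ∈ N \ A, ((N.card : ℝ) - k - 1) * g A +
      ∑ v ∈ N \ (insert u A), g (insert v (insert u A)) ≤
      ((N.card : ℝ) - k - 1) * g (insert u A) +
        ((∑ v ∈ N \ A, g (insert v A)) - g (insert u A)) := by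
    intro u hu
    obtain ⟨huN, huA⟩ := mem_sdiff.1 hu
    have hsd : N \ insert u A = (N \ A).erase u := by
      ext x; simp only [mem_sdiff, mem_insert, mem_erase]; tauto
    have hc2 : (((N \ insert u A).card : ℕ) : ℝ) = (N.card : ℝ) - k - 1 := by
      rw [cast_card_sdiff (insert_subset huN hAN), card_insert_of_notMem huA, hAc]
      push_cast; ring
    have e2 : (∑ v ∈ N \ A, g (insert v A)) - g (insert u A)
        = ∑ v ∈ N \ insert u A, g (insert v A) := by
      rw [hsd, ← sum_erase_add _ _ hu]; ring
    rw [e2, ← hc2, ← nsmul_eq_mul, ← nsmul_eq_mul, ← sum_const, ← sum_const, ← sum_add_distrib,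
      ← sum_add_distrib]
    refine sum_le_sum fun v hv => ?_
    obtain ⟨hvN, hvA⟩ := mem_sdiff.1 hv
    have := hsub A (insert u A) (subset_insert _ _) (insert_subset huN hAN) v hvN hvA
    rw [union_comm _ {v}, union_comm _ {v}, ← insert_eq, ← insert_eq] at this
    linarith
  refine (sum_le_sum key).trans (le_of_eq ?_)
  rw [sum_add_distrib, sum_sub_distrib, sum_const, nsmul_eq_mul, hc, ← mul_sum]
  ring

lemma aux_concave {α : Type*} [DecidableEq α] (N : Finset α) (k : ℕ) (hk : k + 2 ≤ N.card)
    (g : Finset α → ℝ)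
    (hsub : ∀ A B : Finset α, A ⊆ B → B ⊆ N → ∀ u ∈ N, u ∉ B →
      g (B ∪ {u}) - g B ≤ g (A ∪ {u}) - g A) (a : ℕ → ℝ)
    (ha : ∀ k, k ≤ N.card → (∑ A ∈ N.powersetCard k, g A) = (N.card.choose k : ℝ) * a k) :
    a k + a (k + 2) ≤ 2 * a (k + 1) := by
  have h := aux_ineq N k hk g hsub
  rw [ha k (by omega), ha (k + 1) (by omega), ha (k + 2) hk] at h
  have hkR : (k : ℝ) + 2 ≤ N.card := by exact_mod_cast hk
  have c1 : (N.card.choose (k + 1) : ℝ) * ((k : ℝ) + 1) =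
      (N.card.choose k : ℝ) * ((N.card : ℝ) - k) := by
    have := Nat.choose_succ_right_eq N.card k
    rw [← Nat.cast_sub (by omega : k ≤ N.card)]
    exact_mod_cast this
  have c2 : (N.card.choose (k + 2) : ℝ) * ((k : ℝ) + 2) =
      (N.card.choose (k + 1) : ℝ) * ((N.card : ℝ) - k - 1) := by
    have := Nat.choose_succ_right_eq N.card (k + 1)
    have h3 : (N.card : ℝ) - k - 1 = ((N.card - (k + 1) : ℕ) : ℝ) := by
      rw [Nat.cast_sub (by omega)]; push_cast; ring
    rw [h3]
    exact_mod_cast this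
  have cp : 0 < (N.card.choose (k + 1) : ℝ) := by
    exact_mod_cast Nat.choose_pos (by omega)
  have hD : 0 < (N.card.choose (k + 1) : ℝ) * ((k : ℝ) + 1) * ((N.card : ℝ) - k - 1) := by
    refine mul_pos (mul_pos cp (by positivity)) (by linarith)
  refine le_of_mul_le_mul_left ?_ hD
  have l1 : (N.card.choose (k + 1) : ℝ) * ((k : ℝ) + 1) * ((N.card : ℝ) - k - 1) * (a k + a (k + 2))
      = ((N.card : ℝ) - k) * ((N.card : ℝ) - k - 1) * ((N.card.choose k : ℝ) * a k) +
      ((k : ℝ) + 1) * ((k : ℝ) + 2) * ((N.card.choose (k + 2) : ℝ) * a (k + 2)) := by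
    linear_combination ((N.card : ℝ) - k - 1) * a k * c1 - ((k : ℝ) + 1) * a (k + 2) * c2
  rw [l1]
  linarith

/-- A concave finite sequence has a supergradient at every point. -/
lemma aux_supergrad (n m : ℕ) (hmn : m ≤ n) (a : ℕ → ℝ)
    (hc : ∀ k, k + 2 ≤ n → a k + a (k + 2) ≤ 2 * a (k + 1)) :
    ∃ d : ℝ, ∀ k, k ≤ n → a k ≤ a m + d * ((k : ℝ) - m) := by
  have anti : ∀ i j, i ≤ j → j + 1 ≤ n → a (j + 1) - a j ≤ a (i + 1) - a i := by
    intro i j hij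
    induction j, hij using Nat.le_induction with
    | base => intro _; exact le_rfl
    | succ j hj ih =>
      intro h
      have := ih (by omega)
      have := hc j (by omega)
      linarith
  have up : ∀ (d : ℝ), (m + 1 ≤ n → a (m + 1) - a m ≤ d) → ∀ t, m + t ≤ n →
      a (m + t) ≤ a m + d * t := by
    intro d hd t
    induction t with
    | zero => intro _; simp
    | succ t ih =>
      intro h
      have h1 := ih (by omega)
      have h2 := anti m (m + t) (by omega) (by omega)
      have h3 := hd (by omega)
      have e : m + (t + 1) = m + t + 1 := by omega
      rw [e]
      push_cast
      linarith
  have down : ∀ (d : ℝ), (∀ i, i + 1 ≤ m → d ≤ a (i + 1) - a i) → ∀ t k, k + t = m →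
      a k ≤ a m - d * t := by
    intro d hd t
    induction t with
    | zero => intro k h; have : k = m := by omega
              subst this; simp
    | succ t ih =>
      intro k h
      have h1 := ih (k + 1) (by omega)
      have h3 := hd k (by omega)
      push_cast
      linarith
  have fin : ∀ (d : ℝ), (m + 1 ≤ n → a (m + 1) - a m ≤ d) →
      (∀ i, i + 1 ≤ m → d ≤ a (i + 1) - a i) →
      ∀ k, k ≤ n → a k ≤ a m + d * ((k : ℝ) - m) := by
    intro d h1 h2 k hk
    rcases le_total m k with h | h
    · obtain ⟨t, rfl⟩ := Nat.exists_eq_add_of_le h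
      have := up d h1 t hk
      push_cast
      linarith
    · obtain ⟨t, ht⟩ := Nat.exists_eq_add_of_le h
      have := down d h2 t k ht.symm
      have e : (m : ℝ) = k + t := by exact_mod_cast ht
      have e2 : (k : ℝ) - m = -t := by linarith
      rw [e2]
      linarith
  rcases Nat.lt_or_ge m n with h | h
  · exact ⟨a (m + 1) - a m, fin _ (fun _ => le_rfl) fun i hi => anti i m (by omega) (by omega)⟩
  · rcases m with _ | m
    · exact ⟨0, fin _ (fun h' => by omega) fun i hi => by omega⟩
    · exact ⟨a (m + 1) - a m, fin _ (fun h' => by omega)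
        fun i hi => anti i m (by omega) (by omega)⟩

lemma aux_bern (n : ℕ) (p : ℝ) :
    ∑ k ∈ range (n + 1), (n.choose k : ℝ) * p ^ k * (1 - p) ^ (n - k) = 1 ∧
    ∑ k ∈ range (n + 1), (k : ℝ) * ((n.choose k : ℝ) * p ^ k * (1 - p) ^ (n - k)) = n * p := by
  constructor
  · have := congrArg (Polynomial.eval p) (bernsteinPolynomial.sum ℝ n)
    simpa [Polynomial.eval_finset_sum, bernsteinPolynomial] using this
  · have := congrArg (Polynomial.eval p) (bernsteinPolynomial.sum_smul ℝ n)
    simpa [Polynomial.eval_finset_sum, bernsteinPolynomial] using this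

/-- If `g` is submodular on subsets of a finite set `N` of size `n`, and `m = p * n`
with `p ∈ [0,1]`, then the expectation of `g` under independent sampling with
probability `p` is at most its expectation under the uniform distribution over
subsets of size exactly `m`. -/
theorem independent_sampling_le_uniform_of_submodular
    {α : Type*} [DecidableEq α] (N : Finset α) (n : ℕ) (hn : N.card = n)
    (p : ℝ) (hp0 : 0 ≤ p) (hp1 : p ≤ 1)
    (m : ℕ) (hm : (m : ℝ) = p * n)
    (g : Finset α → ℝ)
    (hsub : ∀ A B : Finset α, A ⊆ B → B ⊆ N → ∀ u ∈ N, u ∉ B →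
      g (B ∪ {u}) - g B ≤ g (A ∪ {u}) - g A) :
    ∑ A ∈ N.powerset, p ^ A.card * (1 - p) ^ (N.card - A.card) * g A ≤
      (∑ A ∈ N.powersetCard m, g A) / (n.choose m : ℝ) := by
  subst hn
  have hmn : m ≤ N.card := by
    have : (m : ℝ) ≤ N.card := by
      rw [hm]; exact mul_le_of_le_one_left (Nat.cast_nonneg _) hp1
    exact_mod_cast this
  set a : ℕ → ℝ := fun k => (∑ A ∈ N.powersetCard k, g A) / (N.card.choose k : ℝ) with ha_def
  have ha : ∀ k, k ≤ N.card →
      (∑ A ∈ N.powersetCard k, g A) = (N.card.choose k : ℝ) * a k := by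
    intro k hk
    have : (N.card.choose k : ℝ) ≠ 0 := by exact_mod_cast (Nat.choose_pos hk).ne'
    simp only [ha_def]
    field_simp
  obtain ⟨d, hd⟩ := aux_supergrad N.card m hmn a
    fun k hk => aux_concave N k hk g hsub a ha
  obtain ⟨b0, b1⟩ := aux_bern N.card p
  change _ ≤ a m
  rw [Finset.sum_powerset]
  calc ∑ k ∈ range (N.card + 1), ∑ A ∈ N.powersetCard k,
        p ^ A.card * (1 - p) ^ (N.card - A.card) * g A
      = ∑ k ∈ range (N.card + 1), (N.card.choose k : ℝ) * p ^ k * (1 - p) ^ (N.card - k) * a k := by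
        refine sum_congr rfl fun k hk => ?_
        have hk' : k ≤ N.card := by have := mem_range.1 hk; omega
        have : ∑ A ∈ N.powersetCard k, p ^ A.card * (1 - p) ^ (N.card - A.card) * g A =
            ∑ A ∈ N.powersetCard k, p ^ k * (1 - p) ^ (N.card - k) * g A :=
          sum_congr rfl fun A hA => by rw [(mem_powersetCard.1 hA).2]
        rw [this, ← mul_sum, ha k hk']
        ring
    _ ≤ ∑ k ∈ range (N.card + 1), (N.card.choose k : ℝ) * p ^ k * (1 - p) ^ (N.card - k) *
          (a m + d * ((k : ℝ) - m)) := by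
        refine sum_le_sum fun k hk => ?_
        have hk' : k ≤ N.card := by have := mem_range.1 hk; omega
        have : 0 ≤ 1 - p := by linarith
        exact mul_le_mul_of_nonneg_left (hd k hk') (by positivity)
    _ = (a m - d * m) * ∑ k ∈ range (N.card + 1),
            (N.card.choose k : ℝ) * p ^ k * (1 - p) ^ (N.card - k) +
          d * ∑ k ∈ range (N.card + 1),
            (k : ℝ) * ((N.card.choose k : ℝ) * p ^ k * (1 - p) ^ (N.card - k)) := by
        rw [mul_sum, mul_sum, ← sum_add_distrib]
        exact sum_congr rfl fun k _ => by ring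
    _ = a m := by rw [b0, b1, hm]; ring
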